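/- Characterization of representatives of the anchored process: Let Y be a random element of ℝ₀^{ℤ^d} satisfying the tail-process identity with P(Y ∈ E₀) = 1, set ϑ := E[1/|e(Y)|], and let Z = (Z_i)_{i∈ℤ^d} be a random element of E with E[|e(Z)|] < ∞. The following are equivalent: (i) Z is a representative of the anchored process, i.e. E[h(Z)] = E[h(Z^A)] for every shift-invariant measurable h : E → [0,∞) and some (equivalently every) anchoring function A, where Z^A has law P(Y ∈ · | A(Y) = 0); (ii) E[h(Y)] = (1/E[|e(Z)|]) · E[Σ_{k∈e(Z)} h(θ_k Z)] for every measurable h : E₀ → [0,∞); (iii) E[h(Z)] = ϑ^{−1} E[h(Y)/|e(Y)|] for every shift-invariant measurable h : E → [0,∞). -/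

import Mathlib

open MeasureTheory ENNReal Filter ProbabilityTheory

noncomputable section

/-- The space `ℝ^{ℤ^d}` of real-valued fields indexed by `ℤ^d`. -/
abbrev RField (d : ℕ) := (Fin d → ℤ) → ℝ

variable {d : ℕ}

/-- Shift operator: `shift k x = (x_{i+k})_i`, i.e. it moves the origin to `k`. -/
def shift (k : Fin d → ℤ) (x : RField d) : RField d := fun i => x (i + k)

/-- The set of exceedance-points of `x`. -/
def excSet (x : RField d) : Set (Fin d → ℤ) := {k | 1 < |x k|}

open Classical in
/-- Indicator (with values in `ℝ≥0∞`) of the event that `|x k| > s`. -/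
def exIndGT (s : ℝ) (k : Fin d → ℤ) (x : RField d) : ℝ≥0∞ := if s < |x k| then 1 else 0

/-- The tail-process identity:
`E[h(θ_k Y) 1{|Y_k| > 1}] = E[h(Y) 1{|Y_{−k}| > 1}]` for every measurable nonnegative `h`
and every `k ∈ ℤ^d`. -/
def TailIdentity {Ω : Type*} [MeasurableSpace Ω] (μ : Measure Ω) (Y : Ω → RField d) : Prop :=
  ∀ h : RField d → ℝ≥0∞, Measurable h → ∀ k : Fin d → ℤ,
    ∫⁻ ω, h (shift k (Y ω)) * exIndGT 1 k (Y ω) ∂μ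
      = ∫⁻ ω, h (Y ω) * exIndGT 1 (-k) (Y ω) ∂μ

/-- `Y` is exceedance-stationary: for every exceedance-map `τ` which is bijective on a
measurable set `B` (invariant under shifting the origin to exceedance-points, contained in
`ℝ₀^{ℤ^d}`) carrying the law of `Y`, we have `θ_τ Y ≐ Y`. -/
def ExcStationary {Ω : Type*} [MeasurableSpace Ω] (μ : Measure Ω) (Y : Ω → RField d) : Prop :=
  ∀ (B : Set (RField d)) (τ : RField d → Fin d → ℤ),
    MeasurableSet B → Measurable τ →
    (∀ x ∈ B, 1 < |x 0|) →
    (∀ x ∈ B, ∀ k ∈ excSet x, shift k x ∈ B) →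
    (∀ x ∈ B, τ x ∈ excSet x) →
    (∀ x ∈ B, Set.BijOn (fun k => k + τ (shift k x)) (excSet x) (excSet x)) →
    (∀ᵐ ω ∂μ, Y ω ∈ B) →
    Measure.map (fun ω => shift (τ (Y ω)) (Y ω)) μ = Measure.map Y μ

/-- `E₀`: elements of `ℝ₀^{ℤ^d}` with finitely many exceedance-points. -/
def E0set (d : ℕ) : Set (RField d) := {x | 1 < |x 0| ∧ (excSet x).Finite}

/-- `E`: elements of `ℝ^{ℤ^d}` with at least one but finitely many exceedance-points. -/
def Eset (d : ℕ) : Set (RField d) := {x | (excSet x).Nonempty ∧ (excSet x).Finite}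

/-- `l₀`: fields vanishing at infinity. -/
def l0set (d : ℕ) : Set (RField d) := {x | Tendsto (fun i => |x i|) cofinite (nhds 0)}

/-- Uniform norm `‖x‖ = sup_i |x_i|`. -/
def supNorm (x : RField d) : ℝ := ⨆ i, |x i|

/-- `V` is Pareto(α)-distributed: `P(V > y) = y^{-α}` for `y ≥ 1`. -/
def IsPareto {Ω : Type*} [MeasurableSpace Ω] (μ : Measure Ω) (V : Ω → ℝ) (α : ℝ) : Prop :=
  ∀ y : ℝ, 1 ≤ y → μ {ω | y < V ω} = ENNReal.ofReal (y ^ (-α))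

/-- An anchoring function on `S`: a measurable shift-covariant exceedance-map. -/
def IsAnchoringOn (S : Set (RField d)) (A : RField d → Fin d → ℤ) : Prop :=
  Measurable A ∧ ∀ x ∈ S, A x ∈ excSet x ∧ ∀ k ∈ excSet x, A (shift k x) + k = A x

/-- `h` is shift-invariant on `S`. -/
def ShiftInvariantOn (S : Set (RField d)) (h : RField d → ℝ≥0∞) : Prop :=
  ∀ x ∈ S, ∀ k : Fin d → ℤ, h (shift k x) = h x

lemma shift_shift (j k : Fin d → ℤ) (x : RField d) :
    shift k (shift j x) = shift (k + j) x := by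
  funext i
  simp [shift, add_assoc]

lemma measurable_shift (k : Fin d → ℤ) : Measurable (shift k : RField d → RField d) :=
  measurable_pi_lambda _ fun i => measurable_pi_apply (i + k)

lemma mem_excSet_shift (j k : Fin d → ℤ) (x : RField d) :
    k ∈ excSet (shift j x) ↔ k + j ∈ excSet x := Iff.rfl

lemma measurableSet_mem_excSet (k : Fin d → ℤ) : MeasurableSet {x : RField d | k ∈ excSet x} :=
  measurableSet_lt measurable_const (measurable_pi_apply k).abs

lemma measurable_exIndGT (k : Fin d → ℤ) : Measurable (exIndGT 1 k : RField d → ℝ≥0∞) :=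
  Measurable.ite (measurableSet_mem_excSet k) measurable_const measurable_const

lemma exIndGT_of_mem {k : Fin d → ℤ} {x : RField d} (hk : k ∈ excSet x) : exIndGT 1 k x = 1 :=
  if_pos hk

lemma exIndGT_of_notMem {k : Fin d → ℤ} {x : RField d} (hk : k ∉ excSet x) :
    exIndGT 1 k x = 0 :=
  if_neg hk

/-- The sum of `h (θ_k x)` over the exceedance-points `k` of `x`. -/
def excSum (h : RField d → ℝ≥0∞) (x : RField d) : ℝ≥0∞ :=
  ∑' k : Fin d → ℤ, exIndGT 1 k x * h (shift k x)

lemma measurable_excSum {h : RField d → ℝ≥0∞} (hh : Measurable h) : Measurable (excSum h) :=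
  Measurable.tsum fun k => (measurable_exIndGT k).mul (hh.comp (measurable_shift k))

lemma excSum_shift (h : RField d → ℝ≥0∞) (j : Fin d → ℤ) (x : RField d) :
    excSum h (shift j x) = excSum h x := by
  unfold excSum
  rw [← (Equiv.addRight j).tsum_eq fun k => exIndGT 1 k x * h (shift k x)]
  exact tsum_congr fun k => by rw [shift_shift]; rfl

lemma tsum_exIndGT (x : RField d) : ∑' k, exIndGT 1 k x = (excSet x).encard := by
  rw [← ENNReal.tsum_set_one, tsum_subtype (excSet x) fun _ => (1 : ℝ≥0∞)]
  refine tsum_congr fun k => ?_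
  by_cases hk : k ∈ excSet x
  · simp [exIndGT_of_mem hk, hk]
  · simp [exIndGT_of_notMem hk, hk]

lemma excSum_one (x : RField d) : excSum (fun _ => 1) x = (excSet x).encard := by
  simp [excSum, tsum_exIndGT]

lemma excSum_congr_const {h : RField d → ℝ≥0∞} {x : RField d} {c : ℝ≥0∞}
    (hc : ∀ k ∈ excSet x, h (shift k x) = c) : excSum h x = (excSet x).encard * c := by
  rw [← tsum_exIndGT, ← ENNReal.tsum_mul_right]
  refine tsum_congr fun k => ?_
  by_cases hk : k ∈ excSet x
  · rw [hc k hk]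
  · simp [exIndGT_of_notMem hk]

lemma encard_excSet_shift (j : Fin d → ℤ) (x : RField d) :
    ((excSet (shift j x)).encard : ℝ≥0∞) = (excSet x).encard := by
  rw [← excSum_one, ← excSum_one, excSum_shift]

lemma measurable_encard_excSet :
    Measurable fun x : RField d => ((excSet x).encard : ℝ≥0∞) := by
  simp_rw [← excSum_one]
  exact measurable_excSum measurable_const

lemma E0set_subset_Eset : E0set d ⊆ Eset d := fun _ hx => ⟨⟨0, hx.1⟩, hx.2⟩

lemma encard_excSet_ne_zero {x : RField d} (hx : x ∈ Eset d) :
    ((excSet x).encard : ℝ≥0∞) ≠ 0 := by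
  simpa using hx.1.ne_empty

lemma encard_excSet_ne_top {x : RField d} (hx : x ∈ Eset d) :
    ((excSet x).encard : ℝ≥0∞) ≠ ⊤ := by
  simpa using hx.2

/-- Averaging over the exceedance-points leaves the law of the tail process unchanged. -/
lemma TailIdentity.lintegral_excSum_div {Ω : Type*} [MeasurableSpace Ω] {μ : Measure Ω}
    {Y : Ω → RField d} (hY : Measurable Y) (hTI : TailIdentity μ Y)
    (hE : ∀ᵐ ω ∂μ, Y ω ∈ Eset d) {g : RField d → ℝ≥0∞} (hg : Measurable g) :
    ∫⁻ ω, excSum g (Y ω) / (excSet (Y ω)).encard ∂μ = ∫⁻ ω, g (Y ω) ∂μ := by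
  set f : RField d → ℝ≥0∞ := fun x => g x / (excSet x).encard with hf
  have hfm : Measurable f := hg.div measurable_encard_excSet
  calc ∫⁻ ω, excSum g (Y ω) / (excSet (Y ω)).encard ∂μ
      = ∫⁻ ω, ∑' k, f (shift k (Y ω)) * exIndGT 1 k (Y ω) ∂μ := by
        refine lintegral_congr fun ω => ?_
        simp only [excSum, hf, div_eq_mul_inv, ← ENNReal.tsum_mul_right, encard_excSet_shift]
        exact tsum_congr fun k => by ring
    _ = ∑' k, ∫⁻ ω, f (shift k (Y ω)) * exIndGT 1 k (Y ω) ∂μ :=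
        lintegral_tsum fun k =>
          (((hfm.comp (measurable_shift k)).mul (measurable_exIndGT k)).comp hY).aemeasurable
    _ = ∑' k, ∫⁻ ω, f (Y ω) * exIndGT 1 (-k) (Y ω) ∂μ := tsum_congr fun k => hTI f hfm k
    _ = ∫⁻ ω, ∑' k, f (Y ω) * exIndGT 1 (-k) (Y ω) ∂μ :=
        (lintegral_tsum fun k =>
          ((hfm.mul (measurable_exIndGT (-k))).comp hY).aemeasurable).symm
    _ = ∫⁻ ω, g (Y ω) ∂μ := by
        refine lintegral_congr_ae (hE.mono fun ω hω => ?_)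
        have hneg := (Equiv.neg (Fin d → ℤ)).tsum_eq fun k => exIndGT 1 k (Y ω)
        simp only [Equiv.neg_apply] at hneg
        simp only [hf]
        rw [ENNReal.tsum_mul_left, hneg, tsum_exIndGT,
          ENNReal.div_mul_cancel (encard_excSet_ne_zero hω) (encard_excSet_ne_top hω)]

lemma excSum_indicator_anchor {A : RField d → Fin d → ℤ} (hA : IsAnchoringOn (Eset d) A)
    {h : RField d → ℝ≥0∞} (hh : ShiftInvariantOn (Eset d) h) {x : RField d} (hx : x ∈ Eset d) :
    excSum ({x | A x = 0}.indicator h) x = h x := by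
  obtain ⟨hmem, hshift⟩ := hA.2 x hx
  rw [excSum, tsum_eq_single (A x)]
  · have h0 : shift (A x) x ∈ {x | A x = 0} := by simpa using hshift _ hmem
    rw [exIndGT_of_mem hmem, one_mul, Set.indicator_of_mem h0, hh x hx]
  · intro k hk
    by_cases hke : k ∈ excSet x
    · have h0 : shift k x ∉ {x | A x = 0} := fun h0 => hk (by simpa [h0.out] using hshift k hke)
      rw [Set.indicator_of_notMem h0, mul_zero]
    · rw [exIndGT_of_notMem hke, zero_mul]

/-- The law of the anchored process on shift-invariant functionals, before normalization. -/
lemma TailIdentity.setLIntegral_anchor {Ω : Type*} [MeasurableSpace Ω] {μ : Measure Ω}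
    {Y : Ω → RField d} (hY : Measurable Y) (hTI : TailIdentity μ Y)
    (hE : ∀ᵐ ω ∂μ, Y ω ∈ Eset d) {A : RField d → Fin d → ℤ} (hA : IsAnchoringOn (Eset d) A)
    {h : RField d → ℝ≥0∞} (hm : Measurable h) (hh : ShiftInvariantOn (Eset d) h) :
    ∫⁻ x in {x | A x = 0}, h x ∂(Measure.map Y μ)
      = ∫⁻ ω, h (Y ω) / (excSet (Y ω)).encard ∂μ := by
  have hAm : MeasurableSet {x | A x = 0} := hA.1 (measurableSet_singleton 0)
  rw [← lintegral_indicator hAm, lintegral_map (hm.indicator hAm) hY,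
    ← hTI.lintegral_excSum_div hY hE (hm.indicator hAm)]
  exact lintegral_congr_ae (hE.mono fun ω hω => by
    simp only [excSum_indicator_anchor hA hh hω])

lemma TailIdentity.lintegral_cond_anchor {Ω : Type*} [MeasurableSpace Ω] {μ : Measure Ω}
    {Y : Ω → RField d} (hY : Measurable Y) (hTI : TailIdentity μ Y)
    (hE : ∀ᵐ ω ∂μ, Y ω ∈ Eset d) {A : RField d → Fin d → ℤ} (hA : IsAnchoringOn (Eset d) A)
    {h : RField d → ℝ≥0∞} (hm : Measurable h) (hh : ShiftInvariantOn (Eset d) h) :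
    ∫⁻ x, h x ∂(ProbabilityTheory.cond (Measure.map Y μ) {x | A x = 0})
      = (∫⁻ ω, ((excSet (Y ω)).encard)⁻¹ ∂μ)⁻¹ *
          ∫⁻ ω, h (Y ω) / (excSet (Y ω)).encard ∂μ := by
  have h1 := hTI.setLIntegral_anchor hY hE hA (h := fun _ => 1) measurable_const
    fun _ _ _ => rfl
  simp only [setLIntegral_one, one_div] at h1
  rw [ProbabilityTheory.cond, lintegral_smul_measure, hTI.setLIntegral_anchor hY hE hA hm hh, h1,
    smul_eq_mul]

/-- `k` is the lexicographically smallest exceedance-point of `x`. -/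
def IsLexFirst (k : Fin d → ℤ) (x : RField d) : Prop :=
  k ∈ excSet x ∧ ∀ j ∈ excSet x, toLex k ≤ toLex j

lemma IsLexFirst.unique {k l : Fin d → ℤ} {x : RField d} (hk : IsLexFirst k x)
    (hl : IsLexFirst l x) : k = l :=
  toLex.injective ((hk.2 l hl.1).antisymm (hl.2 k hk.1))

lemma measurableSet_isLexFirst (k : Fin d → ℤ) :
    MeasurableSet {x : RField d | IsLexFirst k x} := by
  refine (measurableSet_mem_excSet k).inter ?_
  change MeasurableSet {x : RField d | ∀ j ∈ excSet x, toLex k ≤ toLex j}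
  simp only [Set.ofPred_forall]
  refine MeasurableSet.iInter fun j => ?_
  by_cases hjk : toLex k ≤ toLex j
  · simp [hjk]
  · simp only [hjk, imp_false]
    exact (measurableSet_mem_excSet j).compl

open Classical in
/-- The lexicographically smallest exceedance-point, with default value `0`. -/
def lexFirst (x : RField d) : Fin d → ℤ :=
  if hx : ∃ k, IsLexFirst k x then hx.choose else 0

lemma IsLexFirst.lexFirst_eq {k : Fin d → ℤ} {x : RField d} (hk : IsLexFirst k x) :
    lexFirst x = k := by
  have hx : ∃ k, IsLexFirst k x := ⟨k, hk⟩
  rw [lexFirst, dif_pos hx]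
  exact hx.choose_spec.unique hk

lemma measurable_lexFirst : Measurable (lexFirst : RField d → Fin d → ℤ) := by
  refine measurable_to_countable' fun k => ?_
  have hset : lexFirst ⁻¹' {k} = {x : RField d | IsLexFirst k x} ∪
      ((⋃ j, {x : RField d | IsLexFirst j x})ᶜ ∩ {_x | k = 0}) := by
    ext x
    by_cases hx : ∃ j, IsLexFirst j x
    · obtain ⟨j, hj⟩ := hx
      have hjk : IsLexFirst k x ↔ j = k := ⟨hj.unique, fun h => h ▸ hj⟩
      have hne : ¬ ∀ i, ¬ IsLexFirst i x := fun h => h j hj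
      simp [hj.lexFirst_eq, hjk, hne]
    · have hx0 : lexFirst x = 0 := dif_neg hx
      have hall : ∀ j, ¬ IsLexFirst j x := not_exists.1 hx
      simp [hx0, hall, eq_comm]
  rw [hset]
  exact (measurableSet_isLexFirst k).union
    ((MeasurableSet.iUnion measurableSet_isLexFirst).compl.inter (MeasurableSet.const _))

lemma exists_isLexFirst {x : RField d} (hx : x ∈ Eset d) : ∃ k, IsLexFirst k x :=
  Set.exists_min_image (excSet x) toLex hx.2 hx.1

lemma IsLexFirst.shift {l : Fin d → ℤ} {x : RField d} (hl : IsLexFirst l x) (k : Fin d → ℤ) :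
    IsLexFirst (l - k) (shift k x) := by
  refine ⟨by simpa [mem_excSet_shift] using hl.1, fun j hj => ?_⟩
  have h := sub_le_sub_right (hl.2 _ hj) (toLex k)
  simpa using h

lemma isAnchoringOn_lexFirst : IsAnchoringOn (Eset d) lexFirst := by
  refine ⟨measurable_lexFirst, fun x hx => ?_⟩
  obtain ⟨l, hl⟩ := exists_isLexFirst hx
  refine ⟨hl.lexFirst_eq ▸ hl.1, fun k _ => ?_⟩
  rw [(hl.shift k).lexFirst_eq, hl.lexFirst_eq, sub_add_cancel]

/-- Inversion formula for `Z` against its description by shift-invariant functionals. -/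
lemma TailIdentity.inversion_iff {Ω : Type*} [MeasurableSpace Ω] {μ : Measure Ω}
    [IsProbabilityMeasure μ] {Ω₂ : Type*} [MeasurableSpace Ω₂] {μ₂ : Measure Ω₂}
    [IsProbabilityMeasure μ₂] {Y : Ω → RField d} (hY : Measurable Y) (hTI : TailIdentity μ Y)
    (hE : ∀ᵐ ω ∂μ, Y ω ∈ Eset d) {Z : Ω₂ → RField d} (hZ : Measurable Z)
    (hZE : ∀ᵐ ω ∂μ₂, Z ω ∈ Eset d) (hZfin : ∫⁻ ω, (excSet (Z ω)).encard ∂μ₂ ≠ ⊤) :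
    (∀ h : RField d → ℝ≥0∞, Measurable h →
        ∫⁻ ω, h (Y ω) ∂μ
          = (∫⁻ ω, (excSet (Z ω)).encard ∂μ₂)⁻¹ * ∫⁻ ω, excSum h (Z ω) ∂μ₂) ↔
      (∀ h : RField d → ℝ≥0∞, Measurable h → ShiftInvariantOn (Eset d) h →
        ∫⁻ ω, h (Z ω) ∂μ₂
          = (∫⁻ ω, ((excSet (Y ω)).encard)⁻¹ ∂μ)⁻¹ *
              ∫⁻ ω, h (Y ω) / (excSet (Y ω)).encard ∂μ) := by
  have hZ0 : ∫⁻ ω, ((excSet (Z ω)).encard : ℝ≥0∞) ∂μ₂ ≠ 0 := by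
    intro h0
    replace h0 := (lintegral_eq_zero_iff (measurable_encard_excSet.comp hZ)).1 h0
    obtain ⟨ω, hω, hω'⟩ := (h0.and hZE).exists
    exact encard_excSet_ne_zero hω' hω
  constructor
  · intro H h hm hh
    have key : ∀ h : RField d → ℝ≥0∞, Measurable h → ShiftInvariantOn (Eset d) h →
        ∫⁻ ω, h (Y ω) / (excSet (Y ω)).encard ∂μ
          = (∫⁻ ω, (excSet (Z ω)).encard ∂μ₂)⁻¹ * ∫⁻ ω, h (Z ω) ∂μ₂ := by
      intro h hm hh
      rw [H (fun x => h x / (excSet x).encard) (hm.div measurable_encard_excSet)]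
      congr 1
      refine lintegral_congr_ae (hZE.mono fun ω hω => ?_)
      dsimp only
      rw [excSum_congr_const (c := h (Z ω) / (excSet (Z ω)).encard)
          fun k _ => by rw [hh _ hω, encard_excSet_shift],
        ENNReal.mul_div_cancel (encard_excSet_ne_zero hω) (encard_excSet_ne_top hω)]
    have h1 := key (fun _ => 1) measurable_const fun _ _ _ => rfl
    simp only [one_div, lintegral_one, measure_univ, mul_one] at h1
    rw [h1, inv_inv, key h hm hh, ← mul_assoc, ENNReal.mul_inv_cancel hZ0 hZfin, one_mul]
  · intro H h hm
    have key : ∀ h : RField d → ℝ≥0∞, Measurable h →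
        ∫⁻ ω, excSum h (Z ω) ∂μ₂
          = (∫⁻ ω, ((excSet (Y ω)).encard)⁻¹ ∂μ)⁻¹ * ∫⁻ ω, h (Y ω) ∂μ := by
      intro h hm
      rw [H (excSum h) (measurable_excSum hm) fun x _ k => excSum_shift h k x,
        hTI.lintegral_excSum_div hY hE hm]
    have h1 := key (fun _ => 1) measurable_const
    simp only [excSum_one, lintegral_one, measure_univ, mul_one] at h1
    rw [key h hm, ← h1, ← mul_assoc, ENNReal.inv_mul_cancel hZ0 hZfin, one_mul]

/-- **characterization of representatives of the anchored process.**
Let `Y` satisfy the tail-process identity with `P(Y ∈ E₀) = 1`, set `ϑ = E[1/|e(Y)|]`, and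
let `Z` be a random element of `E` with `E[|e(Z)|] < ∞`. The following are equivalent:
(i) `Z` is a representative of the anchored process (its law agrees with the law of the
anchored process `Z^A` on shift-invariant functionals, for some anchoring function `A`);
(ii) the inversion formula `E[h(Y)] = E[Σ_{k∈e(Z)} h(θ_k Z)] / E[|e(Z)|]` holds for all
measurable `h ≥ 0`;
(iii) `E[h(Z)] = ϑ⁻¹ E[h(Y)/|e(Y)|]` for all shift-invariant measurable `h ≥ 0`. -/
theorem representative_characterization
    {Ω : Type*} [MeasurableSpace Ω] (μ : Measure Ω) [IsProbabilityMeasure μ]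
    {Ω₂ : Type*} [MeasurableSpace Ω₂] (μ₂ : Measure Ω₂) [IsProbabilityMeasure μ₂]
    (Y : Ω → RField d) (hY : Measurable Y) (hTI : TailIdentity μ Y)
    (hE0 : ∀ᵐ ω ∂μ, Y ω ∈ E0set d)
    (ϑ : ℝ≥0∞) (hϑ : ϑ = ∫⁻ ω, ((excSet (Y ω)).encard)⁻¹ ∂μ)
    (Z : Ω₂ → RField d) (hZ : Measurable Z) (hZE : ∀ᵐ ω ∂μ₂, Z ω ∈ Eset d)
    (hZfin : ∫⁻ ω, (excSet (Z ω)).encard ∂μ₂ ≠ ⊤) :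
    ((∃ A : RField d → Fin d → ℤ, IsAnchoringOn (Eset d) A ∧
        ∀ h : RField d → ℝ≥0∞, Measurable h → ShiftInvariantOn (Eset d) h →
          ∫⁻ ω, h (Z ω) ∂μ₂
            = ∫⁻ x, h x ∂(ProbabilityTheory.cond (Measure.map Y μ) {x | A x = 0})) ↔
      (∀ h : RField d → ℝ≥0∞, Measurable h →
        ∫⁻ ω, h (Y ω) ∂μ
          = (∫⁻ ω, (excSet (Z ω)).encard ∂μ₂)⁻¹ *
              ∫⁻ ω, ∑' k : Fin d → ℤ, exIndGT 1 k (Z ω) * h (shift k (Z ω)) ∂μ₂)) ∧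
    ((∀ h : RField d → ℝ≥0∞, Measurable h →
        ∫⁻ ω, h (Y ω) ∂μ
          = (∫⁻ ω, (excSet (Z ω)).encard ∂μ₂)⁻¹ *
              ∫⁻ ω, ∑' k : Fin d → ℤ, exIndGT 1 k (Z ω) * h (shift k (Z ω)) ∂μ₂) ↔
      (∀ h : RField d → ℝ≥0∞, Measurable h → ShiftInvariantOn (Eset d) h →
        ∫⁻ ω, h (Z ω) ∂μ₂
          = ϑ⁻¹ * ∫⁻ ω, h (Y ω) / (excSet (Y ω)).encard ∂μ)) := by
  subst hϑ
  have hE : ∀ᵐ ω ∂μ, Y ω ∈ Eset d := hE0.mono fun ω hω => E0set_subset_Eset hω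
  have hinv := hTI.inversion_iff hY hE hZ hZE hZfin
  refine ⟨Iff.trans ⟨?_, fun H => ?_⟩ hinv.symm, hinv⟩
  · rintro ⟨A, hA, H⟩ h hm hh
    rw [H h hm hh, hTI.lintegral_cond_anchor hY hE hA hm hh]
  · refine ⟨lexFirst, isAnchoringOn_lexFirst, fun h hm hh => ?_⟩
    rw [H h hm hh, hTI.lintegral_cond_anchor hY hE isAnchoringOn_lexFirst hm hh]
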